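/- Let Z be a weight operator satisfying Condition A(p) for some p ≥ 1. For n ≥ 0 let A_n be the smallest closed star-subalgebra of B(H) containing all compact operators and the set {S_α Z^l S_β* : l ≥ 0, np ≤ |α| = |β| < (n+1)p}. Then for all letters i, j ∈ {1,…,d} and every a ∈ A_n, one has S_i* a S_j ∈ A_n. -/

import Mathlib

noncomputable section

instance (α : Type*) [DecidableEq α] : DecidableEq (FreeMonoid α) :=
  fun a b => inferInstanceAs (Decidable (a.toList = b.toList))

/-- The full Fock space of `ℂ^d`, modeled as `ℓ²` of the free monoid on `Fin d`. -/
abbrev FockSpace (d : ℕ) : Type := lp (fun _ : FreeMonoid (Fin d) => ℂ) 2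

/-- The standard basis vector `e_α` of the Fock space. -/
noncomputable def fockBasis (d : ℕ) (α : FreeMonoid (Fin d)) : FockSpace d :=
  lp.single 2 α (1 : ℂ)

/-- `S_α = S_{α₁} ⋯ S_{αₙ}` for a word `α` (with `S_∅ = 1`). -/
noncomputable def wordOp {d : ℕ} (S : Fin d → (FockSpace d →L[ℂ] FockSpace d))
    (α : FreeMonoid (Fin d)) : FockSpace d →L[ℂ] FockSpace d :=
  (α.toList.map S).prod

section Compact

variable {E : Type*} [NormedAddCommGroup E] [InnerProductSpace ℂ E]

theorem IsCompactOperator.mul_clm {T : E →L[ℂ] E} (hT : IsCompactOperator ⇑T) (U : E →L[ℂ] E) :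
    IsCompactOperator ⇑(T * U) :=
  hT.comp_clm U

theorem IsCompactOperator.clm_mul {T : E →L[ℂ] E} (hT : IsCompactOperator ⇑T) (U : E →L[ℂ] E) :
    IsCompactOperator ⇑(U * T) :=
  hT.clm_comp U

theorem IsCompactOperator.commutator_pow {T Z : E →L[ℂ] E}
    (h : IsCompactOperator ⇑(T * Z - Z * T)) (l : ℕ) :
    IsCompactOperator ⇑(Z ^ l * T - T * Z ^ l) := by
  induction l with
  | zero => simpa using isCompactOperator_zero
  | succ l ih =>
    have key : Z ^ (l + 1) * T - T * Z ^ (l + 1)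
        = (Z ^ l * T - T * Z ^ l) * Z - Z ^ l * (T * Z - Z * T) := by
      rw [pow_succ]; noncomm_ring
    rw [key]
    exact (ih.mul_clm Z).sub (h.clm_mul (Z ^ l))

variable [CompleteSpace E]

theorem StarSubalgebra.mem_of_isCompactOperator_sub {A : StarSubalgebra ℂ (E →L[ℂ] E)}
    (hA : ∀ T : E →L[ℂ] E, IsCompactOperator ⇑T → T ∈ A) {X Y : E →L[ℂ] E}
    (hXY : IsCompactOperator ⇑(X - Y)) (hY : Y ∈ A) : X ∈ A := by
  simpa using add_mem (hA _ hXY) hY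

/-- If the range projections of a row of isometries `S` with orthogonal ranges sum to the identity
modulo compact operators, then the operators all of whose corners `(S i)* x (S j)` lie in a
star-subalgebra containing the compact operators form a star-subalgebra. -/
def StarSubalgebra.cornerComap {ι : Type*} [Fintype ι] [DecidableEq ι] {S : ι → (E →L[ℂ] E)}
    (hS : ∀ i j, star (S i) * S j = if i = j then 1 else 0)
    (hsum : IsCompactOperator ⇑(1 - ∑ k, S k * star (S k)))
    (A : StarSubalgebra ℂ (E →L[ℂ] E))
    (hA : ∀ T : E →L[ℂ] E, IsCompactOperator ⇑T → T ∈ A) :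
    StarSubalgebra ℂ (E →L[ℂ] E) where
  carrier := {x | ∀ i j, star (S i) * x * S j ∈ A}
  mul_mem' {a b} ha hb i j := by
    have hcomp := (hsum.clm_mul (star (S i) * a)).mul_clm (b * S j)
    refine A.mem_of_isCompactOperator_sub hA (Y := ∑ k, (star (S i) * a * S k) *
      (star (S k) * b * S j)) ?_ (sum_mem fun k _ => mul_mem (ha i k) (hb k j))
    convert hcomp using 2
    simp only [mul_sub, sub_mul, Finset.mul_sum, Finset.sum_mul, mul_one, mul_assoc]
  add_mem' {a b} ha hb i j := by
    rw [mul_add, add_mul]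
    exact add_mem (ha i j) (hb i j)
  algebraMap_mem' c i j := by
    rw [← Algebra.commutes, mul_assoc, hS]
    split_ifs
    · exact mul_mem (algebraMap_mem A c) (one_mem A)
    · exact mul_mem (algebraMap_mem A c) (zero_mem A)
  star_mem' {a} ha i j := by
    simpa [mul_assoc] using star_mem (ha j i)

end Compact

section FockSpace

variable {d : ℕ}

theorem inner_fockBasis_left (α : FreeMonoid (Fin d)) (f : FockSpace d) :
    inner ℂ (fockBasis d α) f = f α := by
  simp [fockBasis, lp.inner_single_left]

theorem inner_fockBasis (α β : FreeMonoid (Fin d)) :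
    inner ℂ (fockBasis d α) (fockBasis d β) = if α = β then (1 : ℂ) else 0 := by
  rw [inner_fockBasis_left, fockBasis, lp.single_apply, Pi.single_apply]

theorem FockSpace.ext_inner_fockBasis {f g : FockSpace d}
    (h : ∀ α, inner ℂ (fockBasis d α) f = inner ℂ (fockBasis d α) g) : f = g := by
  ext α
  simpa [inner_fockBasis_left] using h α

theorem FockSpace.clm_ext {T U : FockSpace d →L[ℂ] FockSpace d}
    (h : ∀ α, T (fockBasis d α) = U (fockBasis d α)) : T = U := by
  refine lp.ext_continuousLinearMap (ENNReal.ofNat_ne_top (n := nat_lit 2)) fun α => ?_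
  ext1
  exact h α

variable {S : Fin d → (FockSpace d →L[ℂ] FockSpace d)}

theorem FockSpace.inner_star_apply (T : FockSpace d →L[ℂ] FockSpace d) (f g : FockSpace d) :
    inner ℂ f (star T g) = inner ℂ (T f) g := by
  rw [ContinuousLinearMap.star_eq_adjoint, ContinuousLinearMap.adjoint_inner_right]

theorem star_creation_mul_creation
    (hS : ∀ i α, S i (fockBasis d α) = fockBasis d (FreeMonoid.of i * α)) (i j : Fin d) :
    star (S i) * S j = if i = j then 1 else 0 := by
  refine FockSpace.clm_ext fun β => FockSpace.ext_inner_fockBasis fun α => ?_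
  rw [mul_apply_eq_comp, FockSpace.inner_star_apply, hS, hS, inner_fockBasis]
  rcases eq_or_ne i j with rfl | hij
  · simp [inner_fockBasis]
  · have : FreeMonoid.of i * α ≠ FreeMonoid.of j * β := fun h => hij (List.cons.inj h).1
    simp [this, hij]

theorem star_creation_apply_one
    (hS : ∀ i α, S i (fockBasis d α) = fockBasis d (FreeMonoid.of i * α)) (i : Fin d) :
    star (S i) (fockBasis d 1) = 0 := by
  refine FockSpace.ext_inner_fockBasis fun α => ?_
  have : FreeMonoid.of i * α ≠ 1 := List.cons_ne_nil _ _
  rw [FockSpace.inner_star_apply, hS, inner_fockBasis, if_neg this, inner_zero_right]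

theorem isCompactOperator_one_sub_sum_creation
    (hS : ∀ i α, S i (fockBasis d α) = fockBasis d (FreeMonoid.of i * α)) :
    IsCompactOperator ⇑(1 - ∑ k, S k * star (S k)) := by
  have key : 1 - ∑ k, S k * star (S k) =
      (ContinuousLinearMap.toSpanSingleton ℂ (fockBasis d 1)).comp (innerSL ℂ (fockBasis d 1)) := by
    refine FockSpace.clm_ext fun α => ?_
    induction α using FreeMonoid.casesOn with
    | one =>
      have hone : inner ℂ (fockBasis d 1) (fockBasis d 1) = (1 : ℂ) := by
        rw [inner_fockBasis, if_pos rfl]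
      simp [star_creation_apply_one hS, hone, -inner_self_eq_norm_sq_to_K]
    | of_mul j β =>
      have hstar (k : Fin d) : star (S k) (fockBasis d (FreeMonoid.of j * β))
          = if k = j then fockBasis d β else 0 := by
        rw [← hS, ← mul_apply_eq_comp, star_creation_mul_creation hS]
        split_ifs <;> simp
      have hne : (1 : FreeMonoid (Fin d)) ≠ FreeMonoid.of j * β := (List.cons_ne_nil _ _).symm
      simp [hstar, inner_fockBasis, hne, apply_ite, hS]
  rw [key]
  exact (isCompactOperator_of_locallyCompactSpace_dom (innerSL ℂ (fockBasis d 1))).clm_comp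
    (ContinuousLinearMap.toSpanSingleton ℂ (fockBasis d 1))

theorem wordOp_one : wordOp S 1 = 1 := rfl

theorem wordOp_of (i : Fin d) : wordOp S (FreeMonoid.of i) = S i := by
  simp [wordOp]

theorem wordOp_mul (α β : FreeMonoid (Fin d)) :
    wordOp S (α * β) = wordOp S α * wordOp S β := by
  simp [wordOp]

theorem star_creation_mul_wordOp
    (hS : ∀ i α, S i (fockBasis d α) = fockBasis d (FreeMonoid.of i * α)) (i j : Fin d)
    (α : FreeMonoid (Fin d)) :
    star (S i) * wordOp S (FreeMonoid.of j * α) = if i = j then wordOp S α else 0 := by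
  rw [wordOp_mul, wordOp_of, ← mul_assoc, star_creation_mul_creation hS]
  split_ifs <;> simp

theorem FreeMonoid.exists_of_mul_of_length_pos {ι : Type*} {α : FreeMonoid ι} (h : 0 < α.length) :
    ∃ i β, α = FreeMonoid.of i * β ∧ α.length = β.length + 1 := by
  induction α using FreeMonoid.casesOn with
  | one => simp at h
  | of_mul i β => exact ⟨i, β, rfl, by simp [add_comm]⟩

theorem StarSubalgebra.mul_mem_of_forall_wordOp
    (hsum : IsCompactOperator ⇑(1 - ∑ k, S k * star (S k)))
    {A : StarSubalgebra ℂ (FockSpace d →L[ℂ] FockSpace d)}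
    (hA : ∀ T : FockSpace d →L[ℂ] FockSpace d, IsCompactOperator ⇑T → T ∈ A) (m : ℕ)
    {U V : FockSpace d →L[ℂ] FockSpace d}
    (h : ∀ γ : FreeMonoid (Fin d), γ.length = m → U * wordOp S γ * (star (wordOp S γ) * V) ∈ A) :
    U * V ∈ A := by
  induction m with
  | zero => simpa [wordOp_one] using h 1 rfl
  | succ m ih =>
    refine ih fun γ hγ => A.mem_of_isCompactOperator_sub hA
      (Y := ∑ k, U * wordOp S (γ * FreeMonoid.of k) * (star (wordOp S (γ * FreeMonoid.of k)) * V))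
      ?_ (sum_mem fun k _ => h _ (by simp [hγ]))
    convert (hsum.clm_mul (U * wordOp S γ)).mul_clm (star (wordOp S γ) * V) using 2
    simp only [wordOp_mul, wordOp_of, star_mul, mul_sub, sub_mul, Finset.mul_sum, Finset.sum_mul,
      mul_one, mul_assoc]

/-- Membership in `A` of the corners of `S_α Z^l S_β*`, given that `A` contains the compact
operators and all `S_α Z^l S_β*` with `m ≤ |α| = |β| < m + p`. -/
theorem StarSubalgebra.corner_wordOp_mem
    (hS : ∀ i α, S i (fockBasis d α) = fockBasis d (FreeMonoid.of i * α))
    {Z : FockSpace d →L[ℂ] FockSpace d} {p : ℕ}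
    (hZ : ∀ α : FreeMonoid (Fin d), α.length = p →
      IsCompactOperator ⇑(wordOp S α * Z - Z * wordOp S α))
    {A : StarSubalgebra ℂ (FockSpace d →L[ℂ] FockSpace d)}
    (hA : ∀ T : FockSpace d →L[ℂ] FockSpace d, IsCompactOperator ⇑T → T ∈ A) {m : ℕ}
    (hgen : ∀ (α β : FreeMonoid (Fin d)) (l : ℕ), α.length = β.length → m ≤ α.length →
      α.length < m + p → wordOp S α * Z ^ l * star (wordOp S β) ∈ A)
    {α β : FreeMonoid (Fin d)} (l : ℕ) (hαβ : α.length = β.length) (hmα : m ≤ α.length)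
    (hαp : α.length < m + p) (i j : Fin d) :
    star (S i) * (wordOp S α * Z ^ l * star (wordOp S β)) * S j ∈ A := by
  have of_lt {α β : FreeMonoid (Fin d)} (hαβ : α.length = β.length) (hmα : m < α.length)
      (hαp : α.length ≤ m + p) :
      star (S i) * (wordOp S α * Z ^ l * star (wordOp S β)) * S j ∈ A := by
    obtain ⟨a, α, rfl, hα⟩ := FreeMonoid.exists_of_mul_of_length_pos (α := α) (by omega)
    obtain ⟨b, β, rfl, hβ⟩ := FreeMonoid.exists_of_mul_of_length_pos (α := β) (by omega)
    have hright := congrArg star (star_creation_mul_wordOp hS j b β)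
    rw [star_mul, star_star] at hright
    have key : star (S i) * (wordOp S (FreeMonoid.of a * α) * Z ^ l *
        star (wordOp S (FreeMonoid.of b * β))) * S j = (if i = a then wordOp S α else 0) * Z ^ l *
        star (if j = b then wordOp S β else 0) := by
      rw [← hright, ← star_creation_mul_wordOp hS]
      simp only [mul_assoc]
    rw [key]
    split_ifs
    · exact hgen α β l (by omega) (by omega) (by omega)
    all_goals simp [zero_mem]
  rcases hmα.lt_or_eq with hlt | heq
  · exact of_lt hαβ hlt hαp.le
  rw [← mul_assoc, mul_assoc _ (star (wordOp S β))]
  refine mul_mem_of_forall_wordOp (isCompactOperator_one_sub_sum_creation hS) hA p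
    fun γ hγ => A.mem_of_isCompactOperator_sub hA (Y := star (S i) *
      (wordOp S (α * γ) * Z ^ l * star (wordOp S (β * γ))) * S j) ?_
      (of_lt (by simp [hαβ]) (by simp; omega) (by simp; omega))
  have hcomm := ((IsCompactOperator.commutator_pow (hZ γ hγ) l).clm_mul
    (star (S i) * wordOp S α)).mul_clm (star (wordOp S γ) * (star (wordOp S β) * S j))
  convert hcomm using 2
  simp only [wordOp_mul, star_mul]
  noncomm_ring

end FockSpace

open ContinuousLinearMap in
theorem statement10 (d : ℕ) (hd : 1 ≤ d)
    (S : Fin d → (FockSpace d →L[ℂ] FockSpace d))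
    (hS : ∀ (i : Fin d) (α : FreeMonoid (Fin d)),
      S i (fockBasis d α) = fockBasis d (FreeMonoid.of i * α))
    (P : ℕ → (FockSpace d →L[ℂ] FockSpace d))
    (hP : ∀ (k : ℕ) (α : FreeMonoid (Fin d)),
      P k (fockBasis d α) = if α.length = k then fockBasis d α else 0)
    (Z : FockSpace d →L[ℂ] FockSpace d)
    (hZinv : IsUnit Z)
    (hZP : ∀ k : ℕ, Z * P k = P k * Z)
    (hZ0 : Z * P 0 = P 0)
    (p : ℕ) (hp : 1 ≤ p)
    (hAp : ∀ α : FreeMonoid (Fin d), α.length = p →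
      IsCompactOperator ⇑(wordOp S α * Z - Z * wordOp S α))
    (n : ℕ)
    (A : StarSubalgebra ℂ (FockSpace d →L[ℂ] FockSpace d))
    (hA : A = (StarAlgebra.adjoin ℂ
      ({Y : FockSpace d →L[ℂ] FockSpace d | IsCompactOperator ⇑Y} ∪
        {x | ∃ (α β : FreeMonoid (Fin d)) (l : ℕ),
          α.length = β.length ∧ n * p ≤ α.length ∧ α.length < (n + 1) * p ∧
          x = wordOp S α * Z ^ l * adjoint (wordOp S β)})).topologicalClosure) :
    ∀ (i j : Fin d) (a : FockSpace d →L[ℂ] FockSpace d), a ∈ A →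
      adjoint (S i) * a * S j ∈ A := by
  subst hA
  intro i j a ha
  set G := _ ∪ {x | ∃ (α β : FreeMonoid (Fin d)) (l : ℕ), _}
  set A := (StarAlgebra.adjoin ℂ G).topologicalClosure
  have hsub : G ⊆ A := (StarAlgebra.subset_adjoin ℂ G).trans
    (StarSubalgebra.le_topologicalClosure _)
  have hcpt (T : FockSpace d →L[ℂ] FockSpace d) (hT : IsCompactOperator ⇑T) : T ∈ A :=
    hsub (Or.inl hT)
  let B := A.cornerComap (star_creation_mul_creation hS)
    (isCompactOperator_one_sub_sum_creation hS) hcpt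
  have hB : IsClosed (B : Set (FockSpace d →L[ℂ] FockSpace d)) := by
    have : (B : Set (FockSpace d →L[ℂ] FockSpace d)) =
        ⋂ i, ⋂ j, (fun x => star (S i) * x * S j) ⁻¹' A := by
      ext x
      simp only [Set.mem_iInter]
      rfl
    rw [this]
    exact isClosed_iInter fun i => isClosed_iInter fun j =>
      (StarSubalgebra.isClosed_topologicalClosure _).preimage (by fun_prop)
  have hAB : A ≤ B := by
    refine StarSubalgebra.topologicalClosure_minimal (StarAlgebra.adjoin_le ?_) hB
    rintro x (hx | ⟨α, β, l, hαβ, hα, hα', rfl⟩) i j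
    · exact hcpt _ ((hx.clm_mul _).mul_clm _)
    · rw [add_one_mul] at hα'
      refine StarSubalgebra.corner_wordOp_mem hS hAp hcpt (fun α β l h h₁ h₂ => ?_)
        l hαβ hα hα' i j
      exact hsub (Or.inr ⟨α, β, l, h, h₁, by rwa [add_one_mul], rfl⟩)
  exact hAB ha i j
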